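/- Every tree (a network with no reticulations) on n leaves has a cherry cover consisting only of cherry shapes that contains exactly n-1 cherry shapes. -/

import Mathlib

open scoped Classical

noncomputable section

namespace PhyloNet

/-- A directed multigraph on vertex set `ℕ`, given by its multiset of arcs.
Phylogenetic networks are the simple such graphs satisfying `IsNetwork`;
bulged versions are genuinely multigraphs. -/
abbrev Graph := Multiset (ℕ × ℕ)

/-- The vertices of a multigraph: all endpoints of arcs. -/
def verts (M : Graph) : Finset ℕ :=
  M.toFinset.image Prod.fst ∪ M.toFinset.image Prod.snd

/-- Indegree of a vertex (counting parallel arcs with multiplicity). -/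
def indeg (M : Graph) (v : ℕ) : ℕ := Multiset.card (M.filter (fun e => e.2 = v))

/-- Outdegree of a vertex (counting parallel arcs with multiplicity). -/
def outdeg (M : Graph) (v : ℕ) : ℕ := Multiset.card (M.filter (fun e => e.1 = v))

def adj (M : Graph) (u v : ℕ) : Prop := (u, v) ∈ M

/-- A multigraph is acyclic if no vertex reaches itself by a nonempty directed walk. -/
def Acyclic (M : Graph) : Prop := ∀ v : ℕ, ¬ Relation.TransGen (adj M) v v

/-- No parallel arcs. -/
def Simple (M : Graph) : Prop := ∀ e : ℕ × ℕ, M.count e ≤ 1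

/-- The root: the unique vertex of indegree 0 and outdegree 1. -/
def IsRoot (M : Graph) (v : ℕ) : Prop := v ∈ verts M ∧ indeg M v = 0 ∧ outdeg M v = 1

/-- A leaf: a vertex of indegree 1 and outdegree 0. -/
def IsLeaf (M : Graph) (v : ℕ) : Prop := v ∈ verts M ∧ indeg M v = 1 ∧ outdeg M v = 0

/-- A tree vertex: indegree 1 and outdegree at least 2. -/
def IsTreeVertex (M : Graph) (v : ℕ) : Prop := v ∈ verts M ∧ indeg M v = 1 ∧ 2 ≤ outdeg M v

/-- A reticulation: indegree at least 2 and outdegree 1. -/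
def IsRetic (M : Graph) (v : ℕ) : Prop := v ∈ verts M ∧ 2 ≤ indeg M v ∧ outdeg M v = 1

/-- A (phylogenetic) network: a simple DAG with a unique root (indegree 0, outdegree 1),
in which every other vertex is a leaf (indegree 1, outdegree 0), a tree vertex
(indegree 1, outdegree ≥ 2) or a reticulation (indegree ≥ 2, outdegree 1).
The leaves are regarded as labelled by themselves (the label set is the leaf set). -/
def IsNetwork (M : Graph) : Prop :=
  Simple M ∧ Acyclic M ∧ (∃! v, IsRoot M v) ∧
    ∀ v ∈ verts M, IsRoot M v ∨ IsLeaf M v ∨ IsTreeVertex M v ∨ IsRetic M v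

/-- The set of leaves of a multigraph. -/
def leaves (M : Graph) : Finset ℕ :=
  (verts M).filter (fun v => indeg M v = 1 ∧ outdeg M v = 0)

/-- A network is a tree when it has no reticulations. -/
def IsTree (M : Graph) : Prop := IsNetwork M ∧ ∀ v : ℕ, ¬ IsRetic M v

/-- Binary: all vertices have total degree at most 3. -/
def IsBinary (M : Graph) : Prop := ∀ v ∈ verts M, indeg M v + outdeg M v ≤ 3

/-- Semi-binary: all tree vertices have total degree at most 3. -/
def IsSemiBinary (M : Graph) : Prop :=
  ∀ v : ℕ, IsTreeVertex M v → indeg M v + outdeg M v ≤ 3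

/-- The reticulation number: total number of incoming arcs of reticulations minus
the number of reticulations. -/
def reticNumber (M : Graph) : ℕ :=
  ∑ v ∈ (verts M).filter (fun v => 2 ≤ indeg M v), (indeg M v - 1)

/-- The bulged version `B(N)`: replace the outgoing edge of each reticulation of
indegree `k` by `k-1` parallel copies. -/
def bulged (M : Graph) : Graph :=
  M.bind (fun e =>
    Multiset.replicate
      (if 2 ≤ indeg M e.1 ∧ outdeg M e.1 = 1 then indeg M e.1 - 1 else 1) e)

/-- A cherry shape (on distinct vertices `x,y,p` with edges `px, py`) or a
reticulated cherry shape (on distinct vertices `x,y,p_x,p_y` with edges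
`p_x x, p_y p_x, p_y y`, `p_x` a reticulation). -/
inductive Shape : Type where
  | cherry (x y p : ℕ) : Shape
  | retic (x y px py : ℕ) : Shape
deriving DecidableEq

namespace Shape

/-- The edges of a shape. -/
def edges : Shape → Finset (ℕ × ℕ)
  | cherry x y p => {(p, x), (p, y)}
  | retic x y px py => {(px, x), (py, px), (py, y)}

/-- The endpoints of a shape. -/
def endpoints : Shape → Finset ℕ
  | cherry x y _ => {x, y}
  | retic x y _ _ => {x, y}

/-- The internal vertices of a shape. -/
def internals : Shape → Finset ℕ
  | cherry _ _ p => {p}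
  | retic _ _ px py => {px, py}

/-- The middle edge of a reticulated cherry shape. -/
def middleEdge : Shape → Option (ℕ × ℕ)
  | cherry _ _ _ => none
  | retic _ _ px py => some (py, px)

def isCherry : Shape → Bool
  | cherry _ _ _ => true
  | retic _ _ _ _ => false

/-- Validity of a shape as a subgraph of the multigraph `M`: the vertices are
distinct, the edges are present, and the internal reticulation of a reticulated
cherry shape is a reticulation of `M` (indegree ≥ 2 and outdegree ≥ 1). -/
def valid (M : Graph) : Shape → Prop
  | cherry x y p => x ≠ y ∧ x ≠ p ∧ y ≠ p ∧ (p, x) ∈ M ∧ (p, y) ∈ M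
  | retic x y px py =>
      x ≠ y ∧ x ≠ px ∧ x ≠ py ∧ y ≠ px ∧ y ≠ py ∧ px ≠ py ∧
      (px, x) ∈ M ∧ (py, px) ∈ M ∧ (py, y) ∈ M ∧
      2 ≤ indeg M px ∧ 1 ≤ outdeg M px

end Shape

/-- The number of shapes of `P` covering the arc `e`. -/
def covers (P : Finset Shape) (e : ℕ × ℕ) : ℕ :=
  (P.filter (fun A => e ∈ A.edges)).card

/-- A cherry cover of the multigraph `M` with root `r`: a set of valid shapes such
that every arc except the root arc is covered at least once, every outgoing arc of
a reticulation is covered exactly once (so, counted over parallel copies, exactly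
as often as its multiplicity), and every arc covered as the middle edge of a
reticulated cherry shape is covered exactly once. -/
def IsCherryCover (M : Graph) (r : ℕ) (P : Finset Shape) : Prop :=
  (∀ A ∈ P, A.valid M) ∧
  (∀ e ∈ M, e.1 ≠ r → 1 ≤ covers P e) ∧
  (∀ e ∈ M, (2 ≤ indeg M e.1 ∧ 1 ≤ outdeg M e.1) → covers P e = M.count e) ∧
  (∀ e : ℕ × ℕ, (∃ A ∈ P, A.middleEdge = some e) → covers P e = 1)

/-- A cherry decomposition of `M` with root `r`: a set of valid shapes covering
each arc except the root arc exactly once (over parallel copies, exactly as often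
as its multiplicity). -/
def IsCherryDecomp (M : Graph) (r : ℕ) (P : Finset Shape) : Prop :=
  (∀ A ∈ P, A.valid M) ∧
  (∀ e ∈ M, e.1 ≠ r → covers P e = M.count e)

/-- `A` is directly above `B` when an internal vertex of `B` is an endpoint of `A`. -/
def DirectlyAbove (A B : Shape) : Prop := ∃ v ∈ B.internals, v ∈ A.endpoints

/-- `A` is above `B` (within `P`) when some nonempty chain of shapes of `P`, each
directly above the next, leads from `A` to `B`. -/
def Above (P : Finset Shape) : Shape → Shape → Prop :=
  Relation.TransGen (fun A B => A ∈ P ∧ B ∈ P ∧ DirectlyAbove A B)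

/-- A cherry cover is acyclic when no shape is above itself. -/
def AcyclicCover (P : Finset Shape) : Prop := ∀ A : Shape, ¬ Above P A A

/-- A lowest shape of `P`: one that is above no other shape of `P`. -/
def IsLowest (P : Finset Shape) (A : Shape) : Prop :=
  A ∈ P ∧ ∀ B ∈ P, B ≠ A → ¬ Above P A B

/-- `E` is a spanning (directed) tree of `M` rooted at `r`: a subset of the arcs,
on all vertices of `M`, acyclic, in which `r` has indegree 0 and every other
vertex indegree exactly 1. -/
def IsSpanningArborescence (M : Graph) (r : ℕ) (E : Graph) : Prop :=
  E ≤ M ∧ verts E = verts M ∧ Acyclic E ∧ indeg E r = 0 ∧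
    ∀ v ∈ verts E, v ≠ r → indeg E v = 1

/-- `M` has a spanning tree whose leaves are (bijectively labelled by) `L`. -/
def HasSpanningTreeWithLeaves (M : Graph) (L : Finset ℕ) : Prop :=
  ∃ r E, IsRoot M r ∧ IsSpanningArborescence M r E ∧
    ∀ v ∈ verts E, (outdeg E v = 0 ↔ v ∈ L)

/-- A network is tree-based when it has a base tree, i.e. a spanning tree whose
leaves are exactly the (labelled) leaves of the network. -/
def IsTreeBased (M : Graph) : Prop := HasSpanningTreeWithLeaves M (leaves M)

/-- Rename the vertex `a` to `b` in an arc. -/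
def rn (a b : ℕ) (e : ℕ × ℕ) : ℕ × ℕ :=
  (if e.1 = a then b else e.1, if e.2 = a then b else e.2)

/-- The parent of a vertex (an arbitrary in-neighbour; unique for leaves). -/
def parent (M : Graph) (v : ℕ) : ℕ :=
  if h : ∃ p, (p, v) ∈ M then h.choose else 0

/-- `(x,y)` is a cherry: two distinct leaves with a common parent. -/
def IsCherryPair (M : Graph) (x y : ℕ) : Prop :=
  x ≠ y ∧ IsLeaf M x ∧ IsLeaf M y ∧ ∃ p, (p, x) ∈ M ∧ (p, y) ∈ M

/-- `(x,y)` is a reticulated cherry: leaves `x, y` such that the parent of `x` is a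
reticulation that is a child of the parent of `y`. -/
def IsReticCherryPair (M : Graph) (x y : ℕ) : Prop :=
  x ≠ y ∧ IsLeaf M x ∧ IsLeaf M y ∧
    ∃ px py, IsRetic M px ∧ (px, x) ∈ M ∧ (py, px) ∈ M ∧ (py, y) ∈ M

/-- A reducible pair: a cherry or a reticulated cherry. -/
def ReduciblePair (M : Graph) (x y : ℕ) : Prop :=
  IsCherryPair M x y ∨ IsReticCherryPair M x y

/-- Reducing the ordered pair `(x,y)` in the network `M`: delete the edges of the
corresponding cherry shape or reticulated cherry shape, delete isolated vertices,
label unlabelled outdegree-0 vertices by the label of one of their children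
(formally: rename them to that child), and keep the leaf `y` below its parent when
that parent is a multifurcation.  If `(x,y)` is not reducible, do nothing. -/
def reducePair (M : Graph) (xy : ℕ × ℕ) : Graph :=
  let x := xy.1
  let y := xy.2
  if IsCherryPair M x y then
    let p := parent M y
    if outdeg M p = 2 then ((M.erase (p, x)).erase (p, y)).map (rn p y)
    else M.erase (p, x)
  else if IsReticCherryPair M x y then
    let px := parent M x
    let py := parent M y
    let M₁ := M.erase (py, px)
    let M₂ := if indeg M px = 2 then (M₁.erase (px, x)).map (rn px x) else M₁
    if outdeg M py = 2 then (M₂.erase (py, y)).map (rn py y) else M₂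
  else M

/-- Successively reduce the ordered pairs of a sequence. -/
def reduceSeq (M : Graph) : List (ℕ × ℕ) → Graph
  | [] => M
  | e :: S => reduceSeq (reducePair M e) S

/-- Orchard: some sequence of ordered pairs reduces the network to a network on a
single leaf. -/
def IsOrchard (M : Graph) : Prop :=
  ∃ S : List (ℕ × ℕ),
    IsNetwork (reduceSeq M S) ∧ (leaves (reduceSeq M S)).card = 1

/-- One edge contraction: delete an arc and identify its endpoints. -/
def ContractStep (M M' : Graph) : Prop :=
  ∃ e ∈ M, M' = (M.erase e).map (rn e.1 e.2)

/-- `M` can be turned into `M'` by (repeatedly) contracting edges. -/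
def ContractsTo : Graph → Graph → Prop := Relation.ReflTransGen ContractStep

end PhyloNet

namespace PhyloNet

theorem aux_outdeg_pos {M : Graph} {v : ℕ} : v ∈ M.toFinset.image Prod.fst ↔ outdeg M v ≠ 0 := by
  unfold outdeg
  rw [Ne, Multiset.card_eq_zero, Multiset.filter_eq_nil]
  simp

theorem aux_indeg_pos {M : Graph} {v : ℕ} : v ∈ M.toFinset.image Prod.snd ↔ indeg M v ≠ 0 := by
  unfold indeg
  rw [Ne, Multiset.card_eq_zero, Multiset.filter_eq_nil]
  simp

theorem aux_indeg_inj {M : Graph} {e f : ℕ × ℕ} (he : e ∈ M) (hf : f ∈ M) (h : e.2 = f.2)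
    (hd : indeg M e.2 ≤ 1) : e = f := by
  unfold indeg at hd
  have h1 := (Multiset.toFinset_card_le (M.filter (fun g => g.2 = e.2))).trans hd
  rw [Finset.card_le_one] at h1
  exact h1 e (by simp [he]) f (by simp [hf, h])

theorem aux_other {M : Graph} (hS : Simple M) {v : ℕ} (hd : 2 ≤ outdeg M v) (c : ℕ) :
    ∃ x, (v, x) ∈ M ∧ x ≠ c := by
  have hn : M.Nodup := Multiset.nodup_iff_count_le_one.2 hS
  unfold outdeg at hd
  have h1 : 1 < (M.filter (fun g => g.1 = v)).toFinset.card := by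
    rw [Multiset.toFinset_card_of_nodup (hn.filter _)]
    exact hd
  obtain ⟨b, hb, hne⟩ := Finset.exists_mem_ne h1 (v, c)
  simp only [Multiset.mem_toFinset, Multiset.mem_filter] at hb
  obtain ⟨a, b⟩ := b
  obtain ⟨hb, rfl⟩ := hb
  exact ⟨b, hb, fun h => hne (by simp [h])⟩

/-- **Theorem (statement 11).** Every tree on `n` leaves has a cherry cover
consisting only of cherry shapes that contains exactly `n - 1` cherry shapes. -/
theorem tree_has_cherryCover_of_size (N : Graph) (r : ℕ)
    (hN : IsNetwork N) (htree : ∀ v : ℕ, ¬ IsRetic N v) (hr : IsRoot N r) :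
    ∃ P : Finset Shape, IsCherryCover N r P ∧ (∀ A ∈ P, A.isCherry = true) ∧
      P.card = (leaves N).card - 1 := by
  obtain ⟨hS, hA, hU, hV⟩ := hN
  have hV' : ∀ v ∈ verts N, v ≠ r → IsLeaf N v ∨ IsTreeVertex N v := by
    intro v hv hne
    rcases hV v hv with h | h | h | h
    · exact absurd (hU.unique h hr) hne
    · exact Or.inl h
    · exact Or.inr h
    · exact absurd h (htree v)
  have hin1 : ∀ v ∈ verts N, indeg N v ≤ 1 := by
    intro v hv
    by_cases h : v = r
    · subst h; rw [hr.2.1]; omega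
    · rcases hV' v hv h with h | h
      · exact h.2.1.le
      · exact h.2.1.le
  have hm1 : ∀ e ∈ N, e.1 ∈ verts N := fun e he =>
    Finset.mem_union_left _ (Finset.mem_image_of_mem _ (Multiset.mem_toFinset.2 he))
  have hm2 : ∀ e ∈ N, e.2 ∈ verts N := fun e he =>
    Finset.mem_union_right _ (Finset.mem_image_of_mem _ (Multiset.mem_toFinset.2 he))
  have hc : ∀ p, ∃ c, (∃ x, (p, x) ∈ N) → (p, c) ∈ N := by
    intro p
    by_cases h : ∃ x, (p, x) ∈ N
    · exact ⟨h.choose, fun _ => h.choose_spec⟩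
    · exact ⟨0, fun h' => absurd h' h⟩
  choose c hc using hc
  let E := N.toFinset
  let E' := E.filter (fun e => e.2 ≠ c e.1)
  let f : ℕ × ℕ → Shape := fun e => Shape.cherry (c e.1) e.2 e.1
  have hE' : ∀ e, e ∈ E' ↔ e ∈ N ∧ e.2 ≠ c e.1 := by
    intro e; simp [E', E]
  have hloop : ∀ a b, (a, b) ∈ N → b ≠ a := by
    rintro a b h rfl
    exact hA b (Relation.TransGen.single h)
  refine ⟨E'.image f, ⟨?_, ?_, ?_, ?_⟩, ?_, ?_⟩
  · intro A hAm
    obtain ⟨e, he, rfl⟩ := Finset.mem_image.1 hAm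
    rw [hE'] at he
    have h1 := hc e.1 ⟨e.2, he.1⟩
    exact ⟨he.2.symm, hloop _ _ h1, hloop _ _ he.1, h1, he.1⟩
  · intro e he hne
    unfold covers
    rw [Nat.one_le_iff_ne_zero, ← Nat.pos_iff_ne_zero, Finset.card_pos]
    by_cases h : e.2 = c e.1
    · have h2 : 2 ≤ outdeg N e.1 := by
        have h0 : outdeg N e.1 ≠ 0 :=
          aux_outdeg_pos.1 (Finset.mem_image_of_mem _ (Multiset.mem_toFinset.2 he))
        rcases hV' _ (hm1 e he) hne with h | h
        · exact absurd h.2.2 h0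
        · exact h.2.2
      obtain ⟨x, hx, hxc⟩ := aux_other hS h2 (c e.1)
      refine ⟨f (e.1, x), Finset.mem_filter.2 ⟨Finset.mem_image_of_mem _ ((hE' _).2 ⟨hx, hxc⟩), ?_⟩⟩
      simp [f, Shape.edges, ← h]
    · refine ⟨f e, Finset.mem_filter.2 ⟨Finset.mem_image_of_mem _ ((hE' _).2 ⟨he, h⟩), ?_⟩⟩
      simp [f, Shape.edges]
  · intro e he h
    have := hin1 _ (hm1 e he)
    omega
  · rintro e ⟨A, hAm, h⟩
    obtain ⟨e, he, rfl⟩ := Finset.mem_image.1 hAm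
    simp [f, Shape.middleEdge] at h
  · intro A hAm
    obtain ⟨e, he, rfl⟩ := Finset.mem_image.1 hAm
    rfl
  · have hf : Function.Injective f := by
      rintro ⟨a, b⟩ ⟨a', b'⟩ h
      simp only [f, Shape.cherry.injEq] at h
      simp [h.2.1, h.2.2]
    rw [Finset.card_image_of_injective _ hf]
    have e1 : E.card = (E.image Prod.snd).card := by
      rw [Finset.card_image_of_injOn]
      intro a ha b hb hab
      have ha := Multiset.mem_toFinset.1 (Finset.mem_coe.1 ha)
      have hb := Multiset.mem_toFinset.1 (Finset.mem_coe.1 hb)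
      exact aux_indeg_inj ha hb hab (hin1 _ (hm2 a ha))
    have e2 : E.image Prod.snd = (verts N).erase r := by
      ext v
      rw [Finset.mem_erase]
      constructor
      · intro h
        refine ⟨?_, Finset.mem_union_right _ h⟩
        rintro rfl
        exact aux_indeg_pos.1 h hr.2.1
      · rintro ⟨h1, h2⟩
        refine aux_indeg_pos.2 ?_
        rcases hV' v h2 h1 with h | h
        · rw [h.2.1]; simp
        · rw [h.2.1]; simp
    have e3 : E'.card + (E.filter (fun e => ¬ e.2 ≠ c e.1)).card = E.card :=
      Finset.card_filter_add_card_filter_not _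
    have e4 : (E.filter (fun e => ¬ e.2 ≠ c e.1)).card = (E.image Prod.fst).card := by
      rw [← Finset.card_image_of_injOn (s := E.filter (fun e => ¬ e.2 ≠ c e.1)) (f := Prod.fst)]
      · congr 1
        ext v
        simp only [Finset.mem_image, Finset.mem_filter, not_not]
        constructor
        · rintro ⟨e, he, rfl⟩
          exact ⟨e, he.1, rfl⟩
        · rintro ⟨e, he, rfl⟩
          exact ⟨(e.1, c e.1), ⟨Multiset.mem_toFinset.2
            (hc _ ⟨e.2, Multiset.mem_toFinset.1 he⟩), rfl⟩, rfl⟩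
      · intro a ha b hb hab
        have ha := (Finset.mem_filter.1 (Finset.mem_coe.1 ha)).2
        have hb := (Finset.mem_filter.1 (Finset.mem_coe.1 hb)).2
        rw [not_not] at ha hb
        exact Prod.ext hab (by rw [ha, hb, hab])
    have e5 : leaves N = verts N \ E.image Prod.fst := by
      ext v
      unfold leaves
      rw [Finset.mem_filter, Finset.mem_sdiff]
      refine and_congr_right fun hv => ?_
      rw [show v ∈ E.image Prod.fst ↔ outdeg N v ≠ 0 from aux_outdeg_pos, not_not]
      refine ⟨fun h => h.2, fun h => ⟨?_, h⟩⟩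
      by_cases hvr : v = r
      · subst hvr
        have := hr.2.2
        omega
      · rcases hV' v hv hvr with h | h
        · exact h.2.1
        · exact h.2.1
    have hsub : E.image Prod.fst ⊆ verts N := Finset.subset_union_left
    have e6 : (leaves N).card = (verts N).card - (E.image Prod.fst).card := by
      rw [e5, Finset.card_sdiff_of_subset hsub]
    have e7 := Finset.card_erase_of_mem hr.1
    have e8 := Finset.card_le_card hsub
    rw [e2] at e1
    omega

end PhyloNet
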